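/- arXiv:2301.09214 — 2 statements merged into one kernel-verified Lean document; each statement's English description precedes it below -/
import Mathlib

section
/- The pathwise value function U is jointly continuous: the map (t,x) ↦ U(t,x) is continuous on (0,T) × ℝⁿ. -/
open MeasureTheory Set

/-- The controlled path `Z_s^{t,x,u} = x + ∫_t^s u(r) dr + √ν (W(s) - W(t))`. -/
noncomputable def ctrlPath {n : ℕ} (ν : ℝ) (W : ℝ → EuclideanSpace ℝ (Fin n))
    (t : ℝ) (x : EuclideanSpace ℝ (Fin n)) (u : ℝ → EuclideanSpace ℝ (Fin n))
    (s : ℝ) : EuclideanSpace ℝ (Fin n) :=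
  x + (∫ r in t..s, u r) + Real.sqrt ν • (W s - W t)

/-- The pathwise action `J(t,x,u)`. -/
noncomputable def action {n : ℕ} (T ν : ℝ) (W : ℝ → EuclideanSpace ℝ (Fin n))
    (V S : EuclideanSpace ℝ (Fin n) → ℝ) (t : ℝ) (x : EuclideanSpace ℝ (Fin n))
    (u : ℝ → EuclideanSpace ℝ (Fin n)) : ℝ :=
  (∫ s in t..T, (‖u s‖ ^ 2 / 2 + V (ctrlPath ν W t x u s))) + S (ctrlPath ν W t x u T)

/-- An admissible control: measurable and uniformly bounded by `C`. -/
def IsAdmissible {n : ℕ} (C : ℝ) (u : ℝ → EuclideanSpace ℝ (Fin n)) : Prop :=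
  Measurable u ∧ ∀ s, ‖u s‖ ≤ C

/-- The pathwise value function `U(t,x) = inf { J(t,x,u) : u admissible }`. -/
noncomputable def value {n : ℕ} (T ν C : ℝ) (W : ℝ → EuclideanSpace ℝ (Fin n))
    (V S : EuclideanSpace ℝ (Fin n) → ℝ) (t : ℝ) (x : EuclideanSpace ℝ (Fin n)) : ℝ :=
  sInf {r | ∃ u : ℝ → EuclideanSpace ℝ (Fin n), IsAdmissible C u ∧ r = action T ν W V S t x u}

open Filter Topology in
theorem adm_intervalIntegrable {n : ℕ} {C : ℝ} {u : ℝ → EuclideanSpace ℝ (Fin n)}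
    (hu : IsAdmissible C u) (a b : ℝ) : IntervalIntegrable u volume a b := by
  refine (intervalIntegrable_const (c := C)).mono_fun hu.1.aestronglyMeasurable ?_
  refine Eventually.of_forall fun s => ?_
  exact (hu.2 s).trans (le_abs_self C)

theorem integrand_intervalIntegrable {n : ℕ} {T ν C L_V Vbound : ℝ}
    {W : ℝ → EuclideanSpace ℝ (Fin n)} (hW : ContinuousOn W (Icc 0 T))
    {V : EuclideanSpace ℝ (Fin n) → ℝ}
    (hVlip : ∀ y y', |V y - V y'| ≤ L_V * ‖y - y'‖)
    (hVbdd : ∀ y, |V y| ≤ Vbound)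
    {u : ℝ → EuclideanSpace ℝ (Fin n)} (hu : IsAdmissible C u)
    (t : ℝ) (x : EuclideanSpace ℝ (Fin n)) {a b : ℝ}
    (ha : a ∈ Icc 0 T) (hb : b ∈ Icc 0 T) :
    IntervalIntegrable (fun s => ‖u s‖ ^ 2 / 2 + V (ctrlPath ν W t x u s)) volume a b := by
  have hV : Continuous V := by
    have : LipschitzWith (Real.toNNReal L_V) V := by
      refine LipschitzWith.of_dist_le_mul fun y y' => ?_
      rw [Real.dist_eq, dist_eq_norm]
      refine (hVlip y y').trans ?_
      gcongr
      exact Real.le_coe_toNNReal L_V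
    exact this.continuous
  have hI : Continuous (fun s => ∫ r in t..s, u r) :=
    intervalIntegral.continuous_primitive (fun a b => adm_intervalIntegrable hu a b) t
  have hZ : ContinuousOn (fun s => V (ctrlPath ν W t x u s)) (Icc 0 T) := by
    refine hV.comp_continuousOn ?_
    unfold ctrlPath
    have hI' := hI.continuousOn (s := Icc 0 T)
    fun_prop
  refine IntervalIntegrable.add ?_ ?_
  · refine (intervalIntegrable_const (c := C ^ 2 / 2)).mono_fun ?_ ?_
    · exact ((hu.1.norm.pow_const 2).div_const 2).aestronglyMeasurable
    · refine Filter.Eventually.of_forall fun s => ?_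
      have h1 := hu.2 s
      have h0 := norm_nonneg (u s)
      simp only [Real.norm_eq_abs]
      rw [abs_of_nonneg (by positivity), abs_of_nonneg (by positivity)]
      gcongr
  · exact (hZ.mono (uIcc_subset_Icc ha hb)).intervalIntegrable

theorem integrand_bound {n : ℕ} {C Vbound : ℝ}
    {V : EuclideanSpace ℝ (Fin n) → ℝ}
    (hVbdd : ∀ y, |V y| ≤ Vbound)
    {u : ℝ → EuclideanSpace ℝ (Fin n)} (hu : IsAdmissible C u)
    (s : ℝ) (y : EuclideanSpace ℝ (Fin n)) :
    ‖‖u s‖ ^ 2 / 2 + V y‖ ≤ C ^ 2 / 2 + Vbound := by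
  have h1 := hu.2 s
  have h0 := norm_nonneg (u s)
  have h2 : ‖u s‖ ^ 2 ≤ C ^ 2 := by gcongr
  refine (norm_add_le _ _).trans ?_
  rw [Real.norm_eq_abs, Real.norm_eq_abs, abs_of_nonneg (by positivity)]
  linarith [hVbdd y]

theorem ctrlPath_diff {n : ℕ} {ν C : ℝ} {W : ℝ → EuclideanSpace ℝ (Fin n)}
    {u : ℝ → EuclideanSpace ℝ (Fin n)} (hu : IsAdmissible C u)
    (t t' : ℝ) (x x' : EuclideanSpace ℝ (Fin n)) (s : ℝ) :
    ‖ctrlPath ν W t x u s - ctrlPath ν W t' x' u s‖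
      ≤ ‖x - x'‖ + C * |t - t'| + Real.sqrt ν * ‖W t - W t'‖ := by
  have h : ctrlPath ν W t x u s - ctrlPath ν W t' x' u s
      = (x - x') + (∫ r in t..t', u r) - Real.sqrt ν • (W t - W t') := by
    unfold ctrlPath
    rw [← intervalIntegral.integral_add_adjacent_intervals
      (adm_intervalIntegrable hu t t') (adm_intervalIntegrable hu t' s)]
    module
  rw [h]
  have h2 : ‖∫ r in t..t', u r‖ ≤ C * |t - t'| := by
    rw [abs_sub_comm]
    exact intervalIntegral.norm_integral_le_of_norm_le_const fun r _ => hu.2 r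
  refine (norm_sub_le _ _).trans ?_
  rw [norm_smul, Real.norm_eq_abs, abs_of_nonneg (Real.sqrt_nonneg ν)]
  gcongr
  exact (norm_add_le _ _).trans (by gcongr)

theorem action_diff {n : ℕ} {T ν C L_V L_S Vbound : ℝ}
    {W : ℝ → EuclideanSpace ℝ (Fin n)} (hW : ContinuousOn W (Icc 0 T))
    {V S : EuclideanSpace ℝ (Fin n) → ℝ}
    (hVlip : ∀ y y', |V y - V y'| ≤ L_V * ‖y - y'‖)
    (hVbdd : ∀ y, |V y| ≤ Vbound)
    (hSlip : ∀ y y', |S y - S y'| ≤ L_S * ‖y - y'‖)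
    {u : ℝ → EuclideanSpace ℝ (Fin n)} (hu : IsAdmissible C u)
    {t t' : ℝ} (ht : t ∈ Icc 0 T) (ht' : t' ∈ Icc 0 T) (x x' : EuclideanSpace ℝ (Fin n)) :
    |action T ν W V S t x u - action T ν W V S t' x' u|
      ≤ (C ^ 2 / 2 + Vbound) * |t - t'|
        + (|L_V| * T + |L_S|) * (‖x - x'‖ + C * |t - t'| + Real.sqrt ν * ‖W t - W t'‖) := by
  set D := ‖x - x'‖ + C * |t - t'| + Real.sqrt ν * ‖W t - W t'‖ with hD
  have hd : ∀ s, ‖ctrlPath ν W t x u s - ctrlPath ν W t' x' u s‖ ≤ D :=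
    fun s => ctrlPath_diff hu t t' x x' s
  have hD0 : 0 ≤ D := (norm_nonneg _).trans (hd 0)
  have hTT : T ∈ Icc 0 T := ⟨ht.1.trans ht.2, le_rfl⟩
  have i1 := integrand_intervalIntegrable (ν := ν) hW hVlip hVbdd hu t x ht ht'
  have i2 := integrand_intervalIntegrable (ν := ν) hW hVlip hVbdd hu t x ht' hTT
  have i3 := integrand_intervalIntegrable (ν := ν) hW hVlip hVbdd hu t' x' ht' hTT
  have key : action T ν W V S t x u - action T ν W V S t' x' u
      = (∫ s in t..t', (‖u s‖ ^ 2 / 2 + V (ctrlPath ν W t x u s)))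
        + (∫ s in t'..T, ((‖u s‖ ^ 2 / 2 + V (ctrlPath ν W t x u s))
            - (‖u s‖ ^ 2 / 2 + V (ctrlPath ν W t' x' u s))))
        + (S (ctrlPath ν W t x u T) - S (ctrlPath ν W t' x' u T)) := by
    unfold action
    rw [intervalIntegral.integral_sub i2 i3,
      ← intervalIntegral.integral_add_adjacent_intervals i1 i2]
    ring
  have b1 : |∫ s in t..t', (‖u s‖ ^ 2 / 2 + V (ctrlPath ν W t x u s))|
      ≤ (C ^ 2 / 2 + Vbound) * |t - t'| := by
    rw [abs_sub_comm]
    exact intervalIntegral.norm_integral_le_of_norm_le_const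
      fun s _ => integrand_bound hVbdd hu s _
  have b2 : |∫ s in t'..T, ((‖u s‖ ^ 2 / 2 + V (ctrlPath ν W t x u s))
            - (‖u s‖ ^ 2 / 2 + V (ctrlPath ν W t' x' u s)))| ≤ |L_V| * D * T := by
    have : |∫ s in t'..T, ((‖u s‖ ^ 2 / 2 + V (ctrlPath ν W t x u s))
            - (‖u s‖ ^ 2 / 2 + V (ctrlPath ν W t' x' u s)))| ≤ |L_V| * D * |T - t'| := by
      rw [← Real.norm_eq_abs (∫ s in t'..T, _)]
      refine intervalIntegral.norm_integral_le_of_norm_le_const fun s _ => ?_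
      rw [add_sub_add_left_eq_sub]
      refine (hVlip _ _).trans ?_
      exact mul_le_mul (le_abs_self _) (hd s) (norm_nonneg _) (abs_nonneg _)
    refine this.trans ?_
    gcongr
    rw [abs_of_nonneg (by linarith [ht'.2])]
    linarith [ht'.1]
  have b3 : |S (ctrlPath ν W t x u T) - S (ctrlPath ν W t' x' u T)| ≤ |L_S| * D :=
    (hSlip _ _).trans (mul_le_mul (le_abs_self _) (hd T) (norm_nonneg _) (abs_nonneg _))
  rw [key]
  refine (abs_add_three _ _ _).trans ?_
  linarith

theorem action_bddBelow {n : ℕ} {T ν C L_S Vbound : ℝ}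
    (W : ℝ → EuclideanSpace ℝ (Fin n))
    {V S : EuclideanSpace ℝ (Fin n) → ℝ}
    (hVbdd : ∀ y, |V y| ≤ Vbound)
    (hSlip : ∀ y y', |S y - S y'| ≤ L_S * ‖y - y'‖)
    (t : ℝ) (x : EuclideanSpace ℝ (Fin n)) :
    BddBelow {r | ∃ u : ℝ → EuclideanSpace ℝ (Fin n),
      IsAdmissible C u ∧ r = action T ν W V S t x u} := by
  refine ⟨-((C ^ 2 / 2 + Vbound) * |T - t|) + (S x - |L_S| *
    (C * |T - t| + ‖Real.sqrt ν • (W T - W t)‖)), ?_⟩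
  rintro r ⟨u, hu, rfl⟩
  unfold action
  have h1 : ‖∫ s in t..T, (‖u s‖ ^ 2 / 2 + V (ctrlPath ν W t x u s))‖
      ≤ (C ^ 2 / 2 + Vbound) * |T - t| :=
    intervalIntegral.norm_integral_le_of_norm_le_const
      fun s _ => integrand_bound hVbdd hu s _
  have h2 : ‖ctrlPath ν W t x u T - x‖ ≤ C * |T - t| + ‖Real.sqrt ν • (W T - W t)‖ := by
    have h3 : ‖∫ r in t..T, u r‖ ≤ C * |T - t| :=
      intervalIntegral.norm_integral_le_of_norm_le_const fun r _ => hu.2 r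
    have h4 : ctrlPath ν W t x u T - x
        = (∫ r in t..T, u r) + Real.sqrt ν • (W T - W t) := by
      unfold ctrlPath
      abel
    rw [h4]
    exact (norm_add_le _ _).trans (by gcongr)
  have h5 := (hSlip (ctrlPath ν W t x u T) x).trans
    (mul_le_mul (le_abs_self _) h2 (norm_nonneg _) (abs_nonneg _))
  have h6 := (abs_le.1 h5).1
  have h7 := (abs_le.1 h1).1
  linarith

theorem value_le {n : ℕ} {T ν C L_V L_S Vbound : ℝ} (hC : 0 < C)
    {W : ℝ → EuclideanSpace ℝ (Fin n)} (hW : ContinuousOn W (Icc 0 T))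
    {V S : EuclideanSpace ℝ (Fin n) → ℝ}
    (hVlip : ∀ y y', |V y - V y'| ≤ L_V * ‖y - y'‖)
    (hVbdd : ∀ y, |V y| ≤ Vbound)
    (hSlip : ∀ y y', |S y - S y'| ≤ L_S * ‖y - y'‖)
    {t t' : ℝ} (ht : t ∈ Icc 0 T) (ht' : t' ∈ Icc 0 T) (x x' : EuclideanSpace ℝ (Fin n)) :
    value T ν C W V S t x - value T ν C W V S t' x'
      ≤ (C ^ 2 / 2 + Vbound) * |t - t'|
        + (|L_V| * T + |L_S|) * (‖x - x'‖ + C * |t - t'| + Real.sqrt ν * ‖W t - W t'‖) := by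
  rw [sub_le_comm]
  refine le_csInf ⟨_, fun _ => 0, ⟨measurable_const, fun s => by simpa using hC.le⟩, rfl⟩ ?_
  rintro r ⟨u, hu, rfl⟩
  have h1 : value T ν C W V S t x ≤ action T ν W V S t x u :=
    csInf_le (action_bddBelow W hVbdd hSlip t x) ⟨u, hu, rfl⟩
  have h2 := (abs_le.1 (action_diff (ν := ν) hW hVlip hVbdd hSlip hu ht ht' x x')).2
  linarith

/-- the pathwise value function is jointly continuous on `(0,T) × ℝⁿ`. -/
theorem statement6
    (n : ℕ) (hn : 1 ≤ n) (T ν C L_V L_S Vbound : ℝ)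
    (hT : 0 < T) (hν : 0 < ν) (hC : 0 < C)
    (W : ℝ → EuclideanSpace ℝ (Fin n)) (hW : ContinuousOn W (Icc 0 T))
    (V S : EuclideanSpace ℝ (Fin n) → ℝ)
    (hVlip : ∀ y y', |V y - V y'| ≤ L_V * ‖y - y'‖)
    (hVbdd : ∀ y, |V y| ≤ Vbound)
    (hSlip : ∀ y y', |S y - S y'| ≤ L_S * ‖y - y'‖) :
    ContinuousOn (fun p : ℝ × EuclideanSpace ℝ (Fin n) => value T ν C W V S p.1 p.2)
      (Ioo 0 T ×ˢ (univ : Set (EuclideanSpace ℝ (Fin n)))) := by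
  rintro ⟨t₀, x₀⟩ ⟨ht₀, -⟩
  simp only at ht₀
  have hIcc : ∀ {t}, t ∈ Ioo 0 T → t ∈ Icc 0 T := fun h => Ioo_subset_Icc_self h
  have hWt : ContinuousAt (fun p : ℝ × EuclideanSpace ℝ (Fin n) => W p.1) (t₀, x₀) :=
    ContinuousAt.comp (f := Prod.fst) (hW.continuousAt (Icc_mem_nhds ht₀.1 ht₀.2))
      continuousAt_fst
  refine ContinuousAt.continuousWithinAt ?_
  rw [ContinuousAt, tendsto_iff_dist_tendsto_zero]
  have hB : ContinuousAt (fun p : ℝ × EuclideanSpace ℝ (Fin n) =>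
      (C ^ 2 / 2 + Vbound) * |p.1 - t₀| + (|L_V| * T + |L_S|) *
        (‖p.2 - x₀‖ + C * |p.1 - t₀| + Real.sqrt ν * ‖W p.1 - W t₀‖)) (t₀, x₀) := by
    have := (hWt.sub (continuousAt_const (y := W t₀))).norm
    fun_prop
  have hB0 := hB.tendsto
  simp only [sub_self, abs_zero, norm_zero, mul_zero, add_zero] at hB0
  refine squeeze_zero' (Filter.Eventually.of_forall fun _ => dist_nonneg) ?_ hB0
  have hev : ∀ᶠ p : ℝ × EuclideanSpace ℝ (Fin n) in nhds (t₀, x₀), p.1 ∈ Ioo 0 T :=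
    continuousAt_fst.eventually (Ioo_mem_nhds ht₀.1 ht₀.2)
  filter_upwards [hev] with p hp
  rw [Real.dist_eq, abs_le]
  have h1 := value_le (ν := ν) hC hW hVlip hVbdd hSlip (hIcc hp) (hIcc ht₀) p.2 x₀
  have h2 := value_le (ν := ν) hC hW hVlip hVbdd hSlip (hIcc ht₀) (hIcc hp) x₀ p.2
  rw [abs_sub_comm t₀, norm_sub_rev x₀, norm_sub_rev (W t₀)] at h2
  exact ⟨by linarith, h1⟩
end

section
/- (Uniqueness.) If u and v are both pathwise viscosity solutions (i.e. simultaneously viscosity subsolutions and supersolutions) of the stochastic HJB equation dv = −√ν ∇v ∘ dW(s) + (V(x) − ‖∇v‖²/2) ds with terminal data S, then u(x,s) = v(x,s) for every (x,s) ∈ ℝⁿ × [0,T]. -/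
open MeasureTheory Set

/-- `φ ∈ C²_b`: twice continuously differentiable with `φ` and its first two derivatives
bounded. -/
def IsC2b {E : Type*} [NormedAddCommGroup E] [NormedSpace ℝ E] (φ : E → ℝ) : Prop :=
  ContDiff ℝ 2 φ ∧ ∃ M : ℝ, ∀ y,
    |φ y| ≤ M ∧ ‖fderiv ℝ φ y‖ ≤ M ∧ ‖fderiv ℝ (fderiv ℝ φ) y‖ ≤ M

/-- `v` (time variable first) is a pathwise viscosity subsolution of the stochastic HJB
equation `dv = −√ν ∇v ∘ dW(s) + (V(x) − ‖∇v‖²/2) ds` with terminal data `S`: `v` is upper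
semicontinuous and bounded above, `v(T,·) ≤ S`, and whenever `φ ∈ C²_b`, `g ∈ C¹` and
`v − Φ_φ − g` (with `Φ_φ(s,x) = φ(x + √ν(W(T) − W(s)))`) attains a local maximum at
`(s₀,x₀) ∈ (0,T) × ℝⁿ`, then `−g′(s₀) ≤ V(x₀) − ‖∇φ(x₀ + √ν(W(T) − W(s₀)))‖²/2`. -/
def IsPathwiseSubsolution {n : ℕ} (T ν : ℝ) (W : ℝ → EuclideanSpace ℝ (Fin n))
    (V S : EuclideanSpace ℝ (Fin n) → ℝ) (v : ℝ → EuclideanSpace ℝ (Fin n) → ℝ) : Prop :=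
  UpperSemicontinuous (fun p : ℝ × EuclideanSpace ℝ (Fin n) => v p.1 p.2) ∧
  (∃ M : ℝ, ∀ s y, v s y ≤ M) ∧
  (∀ y, v T y ≤ S y) ∧
  (∀ (φ : EuclideanSpace ℝ (Fin n) → ℝ) (g : ℝ → ℝ) (s₀ : ℝ) (x₀ : EuclideanSpace ℝ (Fin n)),
    IsC2b φ → ContDiff ℝ 1 g → s₀ ∈ Ioo (0 : ℝ) T →
    IsLocalMax (fun p : ℝ × EuclideanSpace ℝ (Fin n) =>
      v p.1 p.2 - φ (p.2 + Real.sqrt ν • (W T - W p.1)) - g p.1) (s₀, x₀) →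
    -deriv g s₀ ≤ V x₀ - ‖gradient φ (x₀ + Real.sqrt ν • (W T - W s₀))‖ ^ 2 / 2)

/-- `v` (time variable first) is a pathwise viscosity supersolution of the stochastic HJB
equation `dv = −√ν ∇v ∘ dW(s) + (V(x) − ‖∇v‖²/2) ds` with terminal data `S`: defined
symmetrically to `IsPathwiseSubsolution`. -/
def IsPathwiseSupersolution {n : ℕ} (T ν : ℝ) (W : ℝ → EuclideanSpace ℝ (Fin n))
    (V S : EuclideanSpace ℝ (Fin n) → ℝ) (v : ℝ → EuclideanSpace ℝ (Fin n) → ℝ) : Prop :=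
  LowerSemicontinuous (fun p : ℝ × EuclideanSpace ℝ (Fin n) => v p.1 p.2) ∧
  (∃ m : ℝ, ∀ s y, m ≤ v s y) ∧
  (∀ y, S y ≤ v T y) ∧
  (∀ (φ : EuclideanSpace ℝ (Fin n) → ℝ) (g : ℝ → ℝ) (s₀ : ℝ) (x₀ : EuclideanSpace ℝ (Fin n)),
    IsC2b φ → ContDiff ℝ 1 g → s₀ ∈ Ioo (0 : ℝ) T →
    IsLocalMin (fun p : ℝ × EuclideanSpace ℝ (Fin n) =>
      v p.1 p.2 - φ (p.2 + Real.sqrt ν • (W T - W p.1)) - g p.1) (s₀, x₀) →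
    V x₀ - ‖gradient φ (x₀ + Real.sqrt ν • (W T - W s₀))‖ ^ 2 / 2 ≤ -deriv g s₀)

open Filter Topology

lemma bound_of_cs {E F : Type*} [NormedAddCommGroup E] [NormedAddCommGroup F] {f : E → F}
    (hf : Continuous f) (hc : HasCompactSupport f) : ∃ C, ∀ x, ‖f x‖ ≤ C :=
  hc.exists_bound_of_continuous hf

lemma cs_fderiv {E F : Type*} [NormedAddCommGroup E] [NormedSpace ℝ E] [NormedAddCommGroup F]
    [NormedSpace ℝ F] {f : E → F} (hc : HasCompactSupport f) : HasCompactSupport (fderiv ℝ f) :=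
  hc.fderiv (𝕜 := ℝ)

lemma isC2b_of_compactSupport {E : Type*} [NormedAddCommGroup E] [NormedSpace ℝ E] (f : E → ℝ)
    (hs : ContDiff ℝ 2 f) (hc : HasCompactSupport f) : IsC2b f := by
  have hs1 : ContDiff ℝ 1 (fderiv ℝ f) := hs.fderiv_right (le_of_eq one_add_one_eq_two)
  have hs2 : Continuous (fderiv ℝ (fderiv ℝ f)) := hs1.continuous_fderiv one_ne_zero
  have b0 := bound_of_cs hs.continuous hc
  have b1 := bound_of_cs hs1.continuous (cs_fderiv hc)
  have b2 := bound_of_cs hs2 (cs_fderiv (cs_fderiv hc))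
  refine ⟨hs, ?_⟩
  clear hs hc hs1 hs2
  revert b0 b1 b2
  generalize fderiv ℝ (fderiv ℝ f) = f2
  generalize fderiv ℝ f = f1
  rintro ⟨C0, h0⟩ ⟨C1, h1⟩ ⟨C2, h2⟩
  refine ⟨max C0 (max C1 C2), fun y => ⟨?_, ?_, ?_⟩⟩
  · exact (h0 y).trans (le_max_left _ _)
  · exact (h1 y).trans ((le_max_left _ _).trans (le_max_right _ _))
  · exact (h2 y).trans ((le_max_right _ _).trans (le_max_right _ _))

lemma cutoff_exists {n : ℕ} (φ : EuclideanSpace ℝ (Fin n) → ℝ) (hφ : ContDiff ℝ 2 φ)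
    (y₀ : EuclideanSpace ℝ (Fin n)) :
    ∃ ψ : EuclideanSpace ℝ (Fin n) → ℝ, IsC2b ψ ∧ ψ =ᶠ[𝓝 y₀] φ := by
  obtain ⟨b⟩ : Nonempty (ContDiffBump y₀) := ⟨⟨1, 2, by norm_num, by norm_num⟩⟩
  have hb : ContDiff ℝ 2 (b : EuclideanSpace ℝ (Fin n) → ℝ) := b.contDiff
  refine ⟨fun y => b y * φ y, isC2b_of_compactSupport _ (hb.mul hφ)
    b.hasCompactSupport.mul_right, ?_⟩
  filter_upwards [b.eventuallyEq_one] with y hy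
  simp [hy]

lemma sub_transform {n : ℕ} {T ν : ℝ} {W c : ℝ → EuclideanSpace ℝ (Fin n)}
    {V S : EuclideanSpace ℝ (Fin n) → ℝ} {v : ℝ → EuclideanSpace ℝ (Fin n) → ℝ}
    (hc : Continuous c) (hcW : ∀ s ∈ Icc 0 T, c s = Real.sqrt ν • (W T - W s))
    (h : IsPathwiseSubsolution T ν W V S v)
    (φ : EuclideanSpace ℝ (Fin n) → ℝ) (g : ℝ → ℝ) (s₀ : ℝ) (y₀ : EuclideanSpace ℝ (Fin n))
    (hφ : ContDiff ℝ 2 φ) (hg : ContDiff ℝ 1 g) (hs : s₀ ∈ Ioo (0 : ℝ) T)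
    (hmax : ∀ᶠ p in 𝓝 (s₀, y₀), v p.1 (p.2 - c p.1) - φ p.2 - g p.1
      ≤ v s₀ (y₀ - c s₀) - φ y₀ - g s₀) :
    -deriv g s₀ ≤ V (y₀ - c s₀) - ‖gradient φ y₀‖ ^ 2 / 2 := by
  obtain ⟨ψ, hψ, he⟩ := cutoff_exists φ hφ y₀
  have h0 := hcW s₀ ⟨hs.1.le, hs.2.le⟩
  have key := h.2.2.2 ψ g s₀ (y₀ - c s₀) hψ hg hs ?_
  · rw [← h0, sub_add_cancel] at key
    have : gradient ψ y₀ = gradient φ y₀ := by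
      unfold gradient; rw [he.fderiv_eq]
    rwa [this] at key
  · have hΘ : Tendsto (fun p : ℝ × EuclideanSpace ℝ (Fin n) => (p.1, p.2 + c p.1))
        (𝓝 (s₀, y₀ - c s₀)) (𝓝 (s₀, y₀)) := by
      have : Continuous (fun p : ℝ × EuclideanSpace ℝ (Fin n) => (p.1, p.2 + c p.1)) := by fun_prop
      simpa using this.tendsto (s₀, y₀ - c s₀)
    have h2 : Tendsto (fun p : ℝ × EuclideanSpace ℝ (Fin n) => p.2 + c p.1)
        (𝓝 (s₀, y₀ - c s₀)) (𝓝 y₀) := (continuous_snd.tendsto (s₀, y₀)).comp hΘ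
    have h3 : ∀ᶠ p in 𝓝 (s₀, y₀ - c s₀), p.1 ∈ Ioo (0:ℝ) T :=
      (continuous_fst.tendsto (s₀, y₀ - c s₀)).eventually (Ioo_mem_nhds hs.1 hs.2)
    filter_upwards [hΘ.eventually hmax, h2.eventually he, h3] with p hp1 hp2 hp3
    simp only [← h0, ← hcW p.1 ⟨hp3.1.le, hp3.2.le⟩, hp2, sub_add_cancel, he.eq_of_nhds]
    simpa using hp1

lemma super_transform {n : ℕ} {T ν : ℝ} {W c : ℝ → EuclideanSpace ℝ (Fin n)}
    {V S : EuclideanSpace ℝ (Fin n) → ℝ} {v : ℝ → EuclideanSpace ℝ (Fin n) → ℝ}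
    (hc : Continuous c) (hcW : ∀ s ∈ Icc 0 T, c s = Real.sqrt ν • (W T - W s))
    (h : IsPathwiseSupersolution T ν W V S v)
    (φ : EuclideanSpace ℝ (Fin n) → ℝ) (g : ℝ → ℝ) (s₀ : ℝ) (y₀ : EuclideanSpace ℝ (Fin n))
    (hφ : ContDiff ℝ 2 φ) (hg : ContDiff ℝ 1 g) (hs : s₀ ∈ Ioo (0 : ℝ) T)
    (hmin : ∀ᶠ p in 𝓝 (s₀, y₀), v s₀ (y₀ - c s₀) - φ y₀ - g s₀ ≤
      v p.1 (p.2 - c p.1) - φ p.2 - g p.1) :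
    V (y₀ - c s₀) - ‖gradient φ y₀‖ ^ 2 / 2 ≤ -deriv g s₀ := by
  obtain ⟨ψ, hψ, he⟩ := cutoff_exists φ hφ y₀
  have h0 := hcW s₀ ⟨hs.1.le, hs.2.le⟩
  have key := h.2.2.2 ψ g s₀ (y₀ - c s₀) hψ hg hs ?_
  · rw [← h0, sub_add_cancel] at key
    have : gradient ψ y₀ = gradient φ y₀ := by
      unfold gradient; rw [he.fderiv_eq]
    rwa [this] at key
  · have hΘ : Tendsto (fun p : ℝ × EuclideanSpace ℝ (Fin n) => (p.1, p.2 + c p.1))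
        (𝓝 (s₀, y₀ - c s₀)) (𝓝 (s₀, y₀)) := by
      have : Continuous (fun p : ℝ × EuclideanSpace ℝ (Fin n) => (p.1, p.2 + c p.1)) := by fun_prop
      simpa using this.tendsto (s₀, y₀ - c s₀)
    have h2 : Tendsto (fun p : ℝ × EuclideanSpace ℝ (Fin n) => p.2 + c p.1)
        (𝓝 (s₀, y₀ - c s₀)) (𝓝 y₀) := (continuous_snd.tendsto (s₀, y₀)).comp hΘ
    have h3 : ∀ᶠ p in 𝓝 (s₀, y₀ - c s₀), p.1 ∈ Ioo (0:ℝ) T :=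
      (continuous_fst.tendsto (s₀, y₀ - c s₀)).eventually (Ioo_mem_nhds hs.1 hs.2)
    filter_upwards [hΘ.eventually hmin, h2.eventually he, h3] with p hp1 hp2 hp3
    simp only [← h0, ← hcW p.1 ⟨hp3.1.le, hp3.2.le⟩, hp2, sub_add_cancel, he.eq_of_nhds]
    simpa using hp1

lemma grad_quad {n : ℕ} (a b : ℝ) (z y : EuclideanSpace ℝ (Fin n)) :
    gradient (fun y => a / 2 * ‖y - z‖ ^ 2 + b / 2 * ‖y‖ ^ 2) y = a • (y - z) + b • y := by
  apply HasGradientAt.gradient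
  rw [hasGradientAt_iff_hasFDerivAt]
  have h1 : HasFDerivAt (fun y : EuclideanSpace ℝ (Fin n) => ‖y - z‖ ^ 2) _ y :=
    ((hasFDerivAt_id y).sub_const z).norm_sq
  have h2 : HasFDerivAt (fun y : EuclideanSpace ℝ (Fin n) => ‖y‖ ^ 2) _ y :=
    (hasFDerivAt_id y).norm_sq
  refine HasFDerivAt.congr_fderiv ((h1.const_mul (a/2)).add (h2.const_mul (b/2))) ?_
  apply ContinuousLinearMap.ext
  intro w
  have e : (InnerProductSpace.toDual ℝ (EuclideanSpace ℝ (Fin n))) (a • (y - z) + b • y) w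
    = a * inner ℝ (y - z) w + b * inner ℝ y w := by
    rw [InnerProductSpace.toDual_apply_apply, inner_add_left, real_inner_smul_left,
      real_inner_smul_left]
  rw [e]
  simp only [add_apply, smul_apply,  ContinuousLinearMap.comp_apply, ContinuousLinearMap.id_apply, innerSL_apply_apply, id,
    smul_eq_mul, nsmul_eq_mul]
  push_cast
  ring

lemma contDiff_quad {n : ℕ} (a b : ℝ) (z : EuclideanSpace ℝ (Fin n)) :
    ContDiff ℝ 2 (fun y => a / 2 * ‖y - z‖ ^ 2 + b / 2 * ‖y‖ ^ 2) := by
  have h1 : ContDiff ℝ 2 (fun y : EuclideanSpace ℝ (Fin n) => ‖y - z‖ ^ 2) :=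
    (contDiff_id.sub contDiff_const).norm_sq ℝ
  have h2 : ContDiff ℝ 2 (fun y : EuclideanSpace ℝ (Fin n) => ‖y‖ ^ 2) :=
    contDiff_id.norm_sq ℝ
  exact (contDiff_const.mul h1).add (contDiff_const.mul h2)

/-- Convexity inequality for the Hamiltonian. -/
lemma convex_ineq {n : ℕ} (μ : ℝ) (h0 : 0 < μ) (h1 : μ < 1) (p r : EuclideanSpace ℝ (Fin n)) :
    ‖p‖ ^ 2 ≤ ‖p + r‖ ^ 2 / (1 - μ) + ‖r‖ ^ 2 / μ := by
  have h2 : 0 < 1 - μ := by linarith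
  have h3 : ‖p‖ ≤ ‖p + r‖ + ‖r‖ := by
    simpa using norm_sub_le (p + r) r
  have h4 : ‖p‖ ^ 2 ≤ (‖p + r‖ + ‖r‖) ^ 2 := by gcongr
  refine h4.trans ?_
  rw [div_add_div _ _ h2.ne' h0.ne', le_div_iff₀ (by positivity)]
  nlinarith [sq_nonneg (μ * ‖p + r‖ - (1 - μ) * ‖r‖)]

/-- The doubled functional. -/
noncomputable def Psi {n : ℕ} (U U' : ℝ × EuclideanSpace ℝ (Fin n) → ℝ) (μ β k A K : ℝ)
    (q : (ℝ × EuclideanSpace ℝ (Fin n)) × (ℝ × EuclideanSpace ℝ (Fin n))) : ℝ :=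
  (1 - μ) * U q.1 - U' q.2 - k / 2 * ‖q.1.2 - q.2.2‖ ^ 2 - β / 2 * ‖q.1.2‖ ^ 2
    - k / 2 * (q.1.1 - q.2.1) ^ 2 - A * Real.exp (-K * q.1.1)

def SubProp {n : ℕ} (T : ℝ) (U F : ℝ × EuclideanSpace ℝ (Fin n) → ℝ) : Prop :=
  ∀ (φ : EuclideanSpace ℝ (Fin n) → ℝ) (g : ℝ → ℝ) (s₀ : ℝ) (y₀ : EuclideanSpace ℝ (Fin n)),
    ContDiff ℝ 2 φ → ContDiff ℝ 1 g → s₀ ∈ Ioo (0 : ℝ) T →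
    (∀ᶠ p in 𝓝 (s₀, y₀), U p - φ p.2 - g p.1 ≤ U (s₀, y₀) - φ y₀ - g s₀) →
    -deriv g s₀ ≤ F (s₀, y₀) - ‖gradient φ y₀‖ ^ 2 / 2

def SuperProp {n : ℕ} (T : ℝ) (U F : ℝ × EuclideanSpace ℝ (Fin n) → ℝ) : Prop :=
  ∀ (φ : EuclideanSpace ℝ (Fin n) → ℝ) (g : ℝ → ℝ) (s₀ : ℝ) (y₀ : EuclideanSpace ℝ (Fin n)),
    ContDiff ℝ 2 φ → ContDiff ℝ 1 g → s₀ ∈ Ioo (0 : ℝ) T →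
    (∀ᶠ p in 𝓝 (s₀, y₀), U (s₀, y₀) - φ y₀ - g s₀ ≤ U p - φ p.2 - g p.1) →
    F (s₀, y₀) - ‖gradient φ y₀‖ ^ 2 / 2 ≤ -deriv g s₀

lemma max_ineq {n : ℕ} {T : ℝ} {U U' F : ℝ × EuclideanSpace ℝ (Fin n) → ℝ}
    (hU : SubProp T U F) (hU' : SuperProp T U' F) {μ β k A K : ℝ} (hμ0 : 0 < μ) (hμ1 : μ < 1)
    {q : (ℝ × EuclideanSpace ℝ (Fin n)) × (ℝ × EuclideanSpace ℝ (Fin n))}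
    (h1 : q.1.1 ∈ Ioo 0 T) (h2 : q.2.1 ∈ Ioo 0 T)
    (hmax : ∀ r : (ℝ × EuclideanSpace ℝ (Fin n)) × (ℝ × EuclideanSpace ℝ (Fin n)),
      r.1.1 ∈ Icc 0 T → r.2.1 ∈ Icc 0 T → Psi U U' μ β k A K r ≤ Psi U U' μ β k A K q) :
    K * (A * Real.exp (-K * q.1.1)) ≤
      (1 - μ) * F q.1 - F q.2 + β ^ 2 * ‖q.1.2‖ ^ 2 / (2 * μ) := by
  obtain ⟨⟨s, y⟩, ⟨t, z⟩⟩ := q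
  simp only at h1 h2 ⊢
  have hl : 0 < 1 - μ := by linarith
  set l := 1 - μ with hldef
  -- subsolution
  have a1 := hU (fun y' => (k / l) / 2 * ‖y' - z‖ ^ 2 + (β / l) / 2 * ‖y'‖ ^ 2)
    (fun τ => l⁻¹ * (k / 2 * (τ - t) ^ 2 + A * Real.exp (-K * τ))) s y
    (contDiff_quad _ _ _) (by fun_prop) h1 (by
      have : ∀ᶠ p : ℝ × EuclideanSpace ℝ (Fin n) in 𝓝 (s, y), p.1 ∈ Ioo (0:ℝ) T :=
        (continuous_fst.tendsto (s, y)).eventually (Ioo_mem_nhds h1.1 h1.2)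
      filter_upwards [this] with p hp
      have := hmax (p, (t, z)) ⟨hp.1.le, hp.2.le⟩ ⟨h2.1.le, h2.2.le⟩
      simp only [Psi, ← hldef] at this
      have e : ∀ (X a b c : ℝ), X - ((k / l) / 2 * a + (β / l) / 2 * b) - l⁻¹ * c
          = l⁻¹ * (l * X - k / 2 * a - β / 2 * b - c) := by
        intro X a b c; field_simp; ring
      rw [e, e]
      apply mul_le_mul_of_nonneg_left _ (inv_pos.2 hl).le
      linarith)
  have a2 := hU' (fun z' => (-k) / 2 * ‖z' - y‖ ^ 2 + 0 / 2 * ‖z'‖ ^ 2)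
    (fun τ => -(k / 2) * (s - τ) ^ 2) t z
    (contDiff_quad _ _ _) (by fun_prop) h2 (by
      have : ∀ᶠ p : ℝ × EuclideanSpace ℝ (Fin n) in 𝓝 (t, z), p.1 ∈ Ioo (0:ℝ) T :=
        (continuous_fst.tendsto (t, z)).eventually (Ioo_mem_nhds h2.1 h2.2)
      filter_upwards [this] with p hp
      have := hmax ((s, y), p) ⟨h1.1.le, h1.2.le⟩ ⟨hp.1.le, hp.2.le⟩
      simp only [Psi] at this
      rw [norm_sub_rev p.2 y, norm_sub_rev z y]
      linarith)
  have d1 : deriv (fun τ => l⁻¹ * (k / 2 * (τ - t) ^ 2 + A * Real.exp (-K * τ))) s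
      = l⁻¹ * (k * (s - t) - K * (A * Real.exp (-K * s))) := by
    have e1 : HasDerivAt (fun τ : ℝ => (τ - t) ^ 2) _ s := ((hasDerivAt_id s).sub_const t).pow 2
    have e2 : HasDerivAt (fun τ : ℝ => Real.exp (-K * τ)) _ s :=
      ((hasDerivAt_id s).const_mul (-K)).exp
    refine (((e1.const_mul (k/2)).add (e2.const_mul A)).const_mul l⁻¹).deriv.trans ?_
    simp only [id]
    push_cast
    ring
  have d2 : deriv (fun τ => -(k / 2) * (s - τ) ^ 2) t = k * (s - t) := by
    have e1 : HasDerivAt (fun τ : ℝ => (s - τ) ^ 2) _ t := ((hasDerivAt_id t).const_sub s).pow 2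
    rw [(e1.const_mul (-(k/2))).deriv]
    simp
    ring
  rw [grad_quad, d1] at a1
  rw [grad_quad, d2] at a2
  have g1 : (k / l) • (y - z) + (β / l) • y = l⁻¹ • (k • (y - z) + β • y) := by
    rw [smul_add, smul_smul, smul_smul, div_eq_inv_mul, div_eq_inv_mul]
  have g2 : (-k) • (z - y) + (0:ℝ) • z = k • (y - z) := by
    rw [zero_smul, add_zero, neg_smul, ← smul_neg, neg_sub]
  rw [g1, norm_smul, mul_pow, Real.norm_eq_abs, sq_abs] at a1
  rw [g2] at a2
  have cv := convex_ineq μ hμ0 hμ1 (k • (y - z)) (β • y)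
  rw [← hldef] at cv
  have e3 : ‖β • y‖ ^ 2 = β ^ 2 * ‖y‖ ^ 2 := by
    rw [norm_smul, mul_pow, Real.norm_eq_abs, sq_abs]
  rw [e3] at cv
  set P := ‖k • (y - z) + β • y‖ ^ 2
  have a3 := mul_le_mul_of_nonneg_left a1 hl.le
  have a4 : l * -(l⁻¹ * (k * (s - t) - K * (A * Real.exp (-K * s))))
    = -(k * (s - t)) + K * (A * Real.exp (-K * s)) := by field_simp; ring
  have a5 : l * (F (s, y) - l⁻¹ ^ 2 * P / 2) = l * F (s, y) - P / l / 2 := by field_simp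
  rw [a4, a5] at a3
  have a6 : β ^ 2 * ‖y‖ ^ 2 / (2 * μ) = β ^ 2 * ‖y‖ ^ 2 / μ / 2 := by field_simp
  rw [a6]
  linarith

lemma psi_continuous {n : ℕ} {U U' : ℝ × EuclideanSpace ℝ (Fin n) → ℝ}
    (hU : Continuous U) (hU' : Continuous U') (μ β k A K : ℝ) :
    Continuous (Psi U U' μ β k A K) := by
  unfold Psi
  fun_prop

lemma psi_bounds {n : ℕ} {U U' : ℝ × EuclideanSpace ℝ (Fin n) → ℝ} {M μ β k A K : ℝ}
    (hM : 0 < M) (bU : ∀ p, |U p| ≤ M) (bU' : ∀ p, |U' p| ≤ M) (hμ0 : 0 < μ) (hμ1 : μ < 1)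
    (hβ : 0 < β) (hk : 0 < k) (hA : 0 < A)
    (q : (ℝ × EuclideanSpace ℝ (Fin n)) × (ℝ × EuclideanSpace ℝ (Fin n)))
    (hq : 0 < Psi U U' μ β k A K q) :
    β * ‖q.1.2‖ ^ 2 ≤ 4 * M ∧ ‖q.1.2 - q.2.2‖ ^ 2 ≤ 4 * M * k⁻¹ ∧
      (q.1.1 - q.2.1) ^ 2 ≤ 4 * M * k⁻¹ := by
  unfold Psi at hq
  have h1 : (1 - μ) * U q.1 ≤ M := by
    have := (abs_le.1 (bU q.1)).2
    nlinarith
  have h2 := (abs_le.1 (bU' q.2)).1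
  have h3 : 0 ≤ A * Real.exp (-K * q.1.1) := by positivity
  have h4 : 0 ≤ k / 2 * ‖q.1.2 - q.2.2‖ ^ 2 := by positivity
  have h5 : 0 ≤ k / 2 * (q.1.1 - q.2.1) ^ 2 := by positivity
  have h6 : 0 ≤ β / 2 * ‖q.1.2‖ ^ 2 := by positivity
  refine ⟨by linarith, ?_, ?_⟩
  · rw [← div_eq_mul_inv, le_div_iff₀ hk]; linarith
  · rw [← div_eq_mul_inv, le_div_iff₀ hk]; linarith

lemma exists_max {n : ℕ} {T : ℝ} {U U' : ℝ × EuclideanSpace ℝ (Fin n) → ℝ} {M μ β k A K : ℝ}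
    (cU : Continuous U) (cU' : Continuous U')
    (hM : 0 < M) (bU : ∀ p, |U p| ≤ M) (bU' : ∀ p, |U' p| ≤ M) (hμ0 : 0 < μ) (hμ1 : μ < 1)
    (hβ : 0 < β) (hk : 1 ≤ k) (hA : 0 < A)
    (p₀ : ℝ × EuclideanSpace ℝ (Fin n)) (hp₀ : p₀.1 ∈ Icc 0 T)
    (hpos : 0 < Psi U U' μ β k A K (p₀, p₀)) :
    ∃ q ∈ (Icc (0:ℝ) T ×ˢ Metric.closedBall (0 : EuclideanSpace ℝ (Fin n))
          (2 + 4 * M / β + 4 * M)) ×ˢ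
        (Icc (0:ℝ) T ×ˢ Metric.closedBall (0 : EuclideanSpace ℝ (Fin n)) (2 + 4 * M / β + 4 * M)),
      ∀ r : (ℝ × EuclideanSpace ℝ (Fin n)) × (ℝ × EuclideanSpace ℝ (Fin n)),
      r.1.1 ∈ Icc 0 T → r.2.1 ∈ Icc 0 T → Psi U U' μ β k A K r ≤ Psi U U' μ β k A K q := by
  set R := 2 + 4 * M / β + 4 * M with hR
  have hk0 : 0 < k := by linarith
  have key : ∀ r : (ℝ × EuclideanSpace ℝ (Fin n)) × (ℝ × EuclideanSpace ℝ (Fin n)),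
      0 < Psi U U' μ β k A K r → ‖r.1.2‖ ≤ R ∧ ‖r.2.2‖ ≤ R := by
    intro r hr
    obtain ⟨b1, b2, -⟩ := psi_bounds hM bU bU' hμ0 hμ1 hβ hk0 hA r hr
    have b3 : ‖r.1.2‖ ^ 2 ≤ 4 * M / β := by rw [le_div_iff₀ hβ]; linarith
    have b4 : ‖r.1.2‖ ≤ 1 + 4 * M / β := by nlinarith [sq_nonneg (‖r.1.2‖ - 1)]
    have b5 : 4 * M * k⁻¹ ≤ 4 * M := by
      have : k⁻¹ ≤ 1 := inv_le_one_of_one_le₀ hk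
      nlinarith
    have b6 : ‖r.1.2 - r.2.2‖ ≤ 1 + 4 * M := by nlinarith [sq_nonneg (‖r.1.2 - r.2.2‖ - 1)]
    have b7 : ‖r.2.2‖ ≤ ‖r.1.2‖ + ‖r.1.2 - r.2.2‖ := by
      simpa using norm_sub_le r.1.2 (r.1.2 - r.2.2)
    constructor <;> linarith
  have hK : IsCompact ((Icc (0:ℝ) T ×ˢ Metric.closedBall (0 : EuclideanSpace ℝ (Fin n)) R) ×ˢ
        (Icc (0:ℝ) T ×ˢ Metric.closedBall (0 : EuclideanSpace ℝ (Fin n)) R)) :=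
    (isCompact_Icc.prod (isCompact_closedBall _ _)).prod
      (isCompact_Icc.prod (isCompact_closedBall _ _))
  have m0 : (p₀, p₀) ∈ ((Icc (0:ℝ) T ×ˢ Metric.closedBall (0 : EuclideanSpace ℝ (Fin n)) R) ×ˢ
        (Icc (0:ℝ) T ×ˢ Metric.closedBall (0 : EuclideanSpace ℝ (Fin n)) R)) := by
    have := key _ hpos
    simp only [mem_prod, mem_closedBall_zero_iff]
    exact ⟨⟨hp₀, this.1⟩, ⟨hp₀, this.2⟩⟩
  obtain ⟨q, hq, hmax⟩ := hK.exists_isMaxOn ⟨_, m0⟩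
    (psi_continuous cU cU' μ β k A K).continuousOn
  refine ⟨q, hq, fun r h1 h2 => ?_⟩
  by_cases hr : 0 < Psi U U' μ β k A K r
  · have := key r hr
    apply hmax
    simp only [mem_prod, mem_closedBall_zero_iff]
    exact ⟨⟨h1, this.1⟩, ⟨h2, this.2⟩⟩
  · have : Psi U U' μ β k A K (p₀, p₀) ≤ Psi U U' μ β k A K q := hmax m0
    linarith

lemma no_params {n : ℕ} {T : ℝ} (hT : 0 < T) {U U' F : ℝ × EuclideanSpace ℝ (Fin n) → ℝ}
    {M B μ β K ρ : ℝ}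
    (cU : Continuous U) (cU' : Continuous U') (cF : Continuous F)
    (hM : 0 < M) (bU : ∀ p, |U p| ≤ M) (bU' : ∀ p, |U' p| ≤ M) (bF : ∀ p, |F p| ≤ B)
    (hU : SubProp T U F) (hU' : SuperProp T U' F) (hT' : ∀ y, U (T, y) ≤ U' (T, y))
    (hμ0 : 0 < μ) (hμ1 : μ < 1) (hβ : 0 < β) (hK : 0 < K)
    (p₀ : ℝ × EuclideanSpace ℝ (Fin n)) (hp₀ : p₀.1 ∈ Icc 0 T)
    (hρ : 0 < ρ) (hρM : μ * M < ρ)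
    (hpos : ρ ≤ (1 - μ) * U p₀ - U' p₀ - β / 2 * ‖p₀.2‖ ^ 2 - 2 * M * Real.exp (-K * p₀.1)) :
    K * (2 * M * Real.exp (-K * T)) ≤ μ * B + 2 * M * β / μ := by
  have e0 : ∀ k : ℝ, ρ ≤ Psi U U' μ β k (2 * M) K (p₀, p₀) := by
    intro k; simpa [Psi] using hpos
  have ex : ∀ k : ℕ, _ := fun k => exists_max (T := T) (k := (k:ℝ) + 1) (K := K) cU cU' hM bU bU'
    hμ0 hμ1 hβ (by linarith [k.cast_nonneg (α := ℝ)]) (A := 2 * M) (by linarith) p₀ hp₀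
    (hρ.trans_le (e0 _))
  choose q hqK hqmax using ex
  have hcpt : IsCompact ((Icc (0:ℝ) T ×ˢ Metric.closedBall (0 : EuclideanSpace ℝ (Fin n))
          (2 + 4 * M / β + 4 * M)) ×ˢ
        (Icc (0:ℝ) T ×ˢ Metric.closedBall (0 : EuclideanSpace ℝ (Fin n))
          (2 + 4 * M / β + 4 * M))) :=
    (isCompact_Icc.prod (isCompact_closedBall _ _)).prod
      (isCompact_Icc.prod (isCompact_closedBall _ _))
  obtain ⟨a, ha, f, hf, hlim⟩ := hcpt.tendsto_subseq hqK
  have hge : ∀ k : ℕ, ρ ≤ Psi U U' μ β ((k:ℝ) + 1) (2 * M) K (q k) := fun k =>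
    (e0 _).trans (hqmax k (p₀, p₀) hp₀ hp₀)
  have hb : ∀ k : ℕ, _ := fun k => psi_bounds hM bU bU' hμ0 hμ1 hβ
    (by positivity) (by linarith) (q k) (hρ.trans_le (hge k))
  have hinv : Tendsto (fun j => 4 * M * ((f j : ℝ) + 1)⁻¹) atTop (𝓝 0) := by
    have h1 : Tendsto (fun k : ℕ => ((k:ℝ) + 1)⁻¹) atTop (𝓝 0) := by
      simpa using tendsto_one_div_add_atTop_nhds_zero_nat (𝕜 := ℝ)
    simpa using (h1.comp hf.tendsto_atTop).const_mul (4 * M)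
  have l1 : Tendsto (fun j => (q (f j)).1) atTop (𝓝 a.1) := (continuous_fst.tendsto a).comp hlim
  have l2 : Tendsto (fun j => (q (f j)).2) atTop (𝓝 a.2) := (continuous_snd.tendsto a).comp hlim
  have l11 : Tendsto (fun j => (q (f j)).1.1) atTop (𝓝 a.1.1) :=
    (continuous_fst.tendsto _).comp l1
  have l12 : Tendsto (fun j => (q (f j)).1.2) atTop (𝓝 a.1.2) :=
    (continuous_snd.tendsto _).comp l1
  have l21 : Tendsto (fun j => (q (f j)).2.1) atTop (𝓝 a.2.1) :=
    (continuous_fst.tendsto _).comp l2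
  have l22 : Tendsto (fun j => (q (f j)).2.2) atTop (𝓝 a.2.2) :=
    (continuous_snd.tendsto _).comp l2
  have es : a.1.1 = a.2.1 := by
    have := le_of_tendsto_of_tendsto' ((l11.sub l21).pow 2) hinv (fun j => (hb (f j)).2.2)
    have h2 : a.1.1 - a.2.1 = 0 := by
      apply pow_eq_zero_iff (two_ne_zero) |>.1
      exact le_antisymm this (sq_nonneg _)
    linarith
  have ey : a.1.2 = a.2.2 := by
    have := le_of_tendsto_of_tendsto' ((l12.sub l22).norm.pow 2) hinv (fun j => (hb (f j)).2.1)
    have h2 : ‖a.1.2 - a.2.2‖ = 0 := by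
      apply pow_eq_zero_iff (two_ne_zero) |>.1
      exact le_antisymm this (sq_nonneg _)
    exact sub_eq_zero.1 (norm_eq_zero.1 h2)
  have ea : a.2 = a.1 := Prod.ext es.symm ey.symm
  rw [ea] at l2 l21 l22
  have hval : ρ ≤ (1 - μ) * U a.1 - U' a.1 - 2 * M * Real.exp (-K * a.1.1) := by
    have t1 : Tendsto (fun j => (1 - μ) * U (q (f j)).1 - U' (q (f j)).2
        - 2 * M * Real.exp (-K * (q (f j)).1.1)) atTop
        (𝓝 ((1 - μ) * U a.1 - U' a.1 - 2 * M * Real.exp (-K * a.1.1))) :=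
      ((((cU.tendsto _).comp l1).const_mul _).sub ((cU'.tendsto _).comp l2)).sub
        (((Real.continuous_exp.tendsto _).comp (l11.const_mul (-K))).const_mul (2 * M))
    refine ge_of_tendsto' t1 (fun j => (hge (f j)).trans ?_)
    unfold Psi
    have h4 : 0 ≤ ((f j : ℝ) + 1) / 2 * ‖(q (f j)).1.2 - (q (f j)).2.2‖ ^ 2 := by positivity
    have h5 : 0 ≤ ((f j : ℝ) + 1) / 2 * ((q (f j)).1.1 - (q (f j)).2.1) ^ 2 := by positivity
    have h6 : 0 ≤ β / 2 * ‖(q (f j)).1.2‖ ^ 2 := by positivity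
    linarith
  have haI : a.1.1 ∈ Icc 0 T := ha.1.1
  have hUle := (abs_le.1 (bU a.1)).2
  have hUge := (abs_le.1 (bU a.1)).1
  have hU'ge := (abs_le.1 (bU' a.1)).1
  have hne0 : a.1.1 ≠ 0 := by
    intro h
    rw [h, mul_zero, Real.exp_zero] at hval
    nlinarith
  have hneT : a.1.1 ≠ T := by
    intro h
    have h1 : U a.1 ≤ U' a.1 := by
      have := hT' a.1.2
      rwa [← h] at this
    have h2 : 0 ≤ 2 * M * Real.exp (-K * a.1.1) := by positivity
    nlinarith
  have hIoo : Ioo (0:ℝ) T ∈ 𝓝 a.1.1 :=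
    Ioo_mem_nhds (lt_of_le_of_ne haI.1 hne0.symm) (lt_of_le_of_ne haI.2 hneT)
  have hfin : ∀ᶠ j in atTop, K * (2 * M * Real.exp (-K * T)) ≤
      (1 - μ) * F (q (f j)).1 - F (q (f j)).2 + 2 * M * β / μ := by
    filter_upwards [l11.eventually hIoo, l21.eventually hIoo] with j h1 h2
    have m := max_ineq hU hU' hμ0 hμ1 h1 h2 (hqmax (f j))
    have m1 : K * (2 * M * Real.exp (-K * T)) ≤ K * (2 * M * Real.exp (-K * (q (f j)).1.1)) := by
      have : Real.exp (-K * T) ≤ Real.exp (-K * (q (f j)).1.1) := by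
        apply Real.exp_le_exp.2
        nlinarith [h1.2]
      gcongr
    have m2 : β ^ 2 * ‖(q (f j)).1.2‖ ^ 2 / (2 * μ) ≤ 2 * M * β / μ := by
      rw [div_le_div_iff₀ (by positivity) hμ0]
      have := mul_le_mul_of_nonneg_left (hb (f j)).1 (mul_pos hβ hμ0).le
      nlinarith
    linarith
  have t2 : Tendsto (fun j => (1 - μ) * F (q (f j)).1 - F (q (f j)).2 + 2 * M * β / μ) atTop
      (𝓝 ((1 - μ) * F a.1 - F a.1 + 2 * M * β / μ)) :=
    ((((cF.tendsto _).comp l1).const_mul _).sub ((cF.tendsto _).comp l2)).add_const _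
  have := ge_of_tendsto t2 hfin
  have hF := (abs_le.1 (bF a.1)).1
  nlinarith

lemma comparison {n : ℕ} {T : ℝ} (hT : 0 < T) {U U' F : ℝ × EuclideanSpace ℝ (Fin n) → ℝ}
    {M B : ℝ}
    (cU : Continuous U) (cU' : Continuous U') (cF : Continuous F)
    (hM : 0 < M) (hB : 0 < B)
    (bU : ∀ p, |U p| ≤ M) (bU' : ∀ p, |U' p| ≤ M) (bF : ∀ p, |F p| ≤ B)
    (hU : SubProp T U F) (hU' : SuperProp T U' F) (hT' : ∀ y, U (T, y) ≤ U' (T, y))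
    (s : ℝ) (hs : s ∈ Ioc 0 T) (x : EuclideanSpace ℝ (Fin n)) : U (s, x) ≤ U' (s, x) := by
  by_contra! hlt
  obtain ⟨d, hd⟩ : ∃ d, d = U (s, x) - U' (s, x) := ⟨_, rfl⟩
  have hd0 : 0 < d := by linarith
  -- choose K
  obtain ⟨K, hK, hKs⟩ : ∃ K : ℝ, 0 < K ∧ 2 * M * Real.exp (-K * s) ≤ d / 4 := by
    have t0 : Tendsto (fun K : ℝ => K * s) atTop atTop := tendsto_id.atTop_mul_const hs.1
    have t1 : Tendsto (fun K : ℝ => Real.exp (-(K * s))) atTop (𝓝 0) :=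
      Real.tendsto_exp_neg_atTop_nhds_zero.comp t0
    have t2 : Tendsto (fun K : ℝ => 2 * M * Real.exp (-(K * s))) atTop (𝓝 0) := by
      simpa using t1.const_mul (2 * M)
    obtain ⟨K, h1, h2⟩ := ((t2.eventually_le_const (by positivity : (0:ℝ) < d / 4)).and
      (eventually_gt_atTop 0)).exists
    exact ⟨K, h2, by simpa [neg_mul] using h1⟩
  obtain ⟨c, hc⟩ : ∃ c, c = K * (2 * M * Real.exp (-K * T)) := ⟨_, rfl⟩
  have hc0 : 0 < c := by rw [hc]; positivity
  obtain ⟨μ, hμ0, hμ1, hμ2, hμ3⟩ : ∃ μ : ℝ, 0 < μ ∧ μ < 1 ∧ μ * M ≤ d / 8 ∧ μ * B ≤ c / 4 := by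
    refine ⟨min (1/2) (min (d / 8 / M) (c / 4 / B)), by positivity, ?_, ?_, ?_⟩
    · exact (min_le_left _ _).trans_lt (by norm_num)
    · rw [← le_div_iff₀ hM]; exact (min_le_right _ _).trans (min_le_left _ _)
    · rw [← le_div_iff₀ hB]; exact (min_le_right _ _).trans (min_le_right _ _)
  obtain ⟨β, hβ0, hβ1, hβ2⟩ : ∃ β : ℝ, 0 < β ∧ β * (‖x‖ ^ 2 + 1) ≤ d / 2 ∧
      2 * M * β / μ ≤ c / 4 := by
    refine ⟨min (d / 2 / (‖x‖ ^ 2 + 1)) (c / 4 * μ / (2 * M)), by positivity, ?_, ?_⟩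
    · rw [← le_div_iff₀ (by positivity)]; exact min_le_left _ _
    · rw [div_le_iff₀ hμ0, mul_comm (2 * M), ← le_div_iff₀ (by positivity)]
      exact min_le_right _ _
  have hUle := (abs_le.1 (bU (s, x))).2
  have := no_params (ρ := d / 4) hT cU cU' cF hM bU bU' bF hU hU' hT' hμ0 hμ1 hβ0 hK (s, x)
    ⟨hs.1.le, hs.2⟩ (by positivity) (by linarith) (by
      simp only
      nlinarith)
  linarith

lemma main_le {n : ℕ} {T ν : ℝ} (hT : 0 < T)
    {W : ℝ → EuclideanSpace ℝ (Fin n)} (hW : ContinuousOn W (Icc 0 T))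
    {V S : EuclideanSpace ℝ (Fin n) → ℝ} {Vbound : ℝ} (cV : Continuous V)
    (hVbdd : ∀ y, |V y| ≤ Vbound)
    {u v : ℝ → EuclideanSpace ℝ (Fin n) → ℝ}
    (hu_sub : IsPathwiseSubsolution T ν W V S u)
    (hu_super : IsPathwiseSupersolution T ν W V S u)
    (hv_sub : IsPathwiseSubsolution T ν W V S v)
    (hv_super : IsPathwiseSupersolution T ν W V S v)
    (x : EuclideanSpace ℝ (Fin n)) (s : ℝ) (hs : s ∈ Icc (0 : ℝ) T) : u s x ≤ v s x := by
  have cu : Continuous (fun p : ℝ × EuclideanSpace ℝ (Fin n) => u p.1 p.2) :=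
    continuous_iff_lower_upperSemicontinuous.2 ⟨hu_super.1, hu_sub.1⟩
  have cv : Continuous (fun p : ℝ × EuclideanSpace ℝ (Fin n) => v p.1 p.2) :=
    continuous_iff_lower_upperSemicontinuous.2 ⟨hv_super.1, hv_sub.1⟩
  obtain ⟨M1, hM1⟩ := hu_sub.2.1
  obtain ⟨M2, hM2⟩ := hu_super.2.1
  obtain ⟨M3, hM3⟩ := hv_sub.2.1
  obtain ⟨M4, hM4⟩ := hv_super.2.1
  obtain ⟨M, hM⟩ : ∃ M, M = |M1| + |M2| + |M3| + |M4| + 1 := ⟨_, rfl⟩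
  have a1 := le_abs_self M1
  have a2 := neg_abs_le M2
  have a3 := le_abs_self M3
  have a4 := neg_abs_le M4
  have p1 := abs_nonneg M1
  have p2 := abs_nonneg M2
  have p3 := abs_nonneg M3
  have p4 := abs_nonneg M4
  have bu : ∀ s y, |u s y| ≤ M := fun s y => abs_le.2
    ⟨by linarith [hM2 s y], by linarith [hM1 s y]⟩
  have bv : ∀ s y, |v s y| ≤ M := fun s y => abs_le.2
    ⟨by linarith [hM4 s y], by linarith [hM3 s y]⟩
  obtain ⟨c, cc, hcW⟩ : ∃ c : ℝ → EuclideanSpace ℝ (Fin n), Continuous c ∧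
      ∀ s ∈ Icc 0 T, c s = Real.sqrt ν • (W T - W s) := by
    refine ⟨fun s => Real.sqrt ν • (W T - IccExtend hT.le ((Icc 0 T).domRestrict W) s), ?_, ?_⟩
    · have : Continuous (IccExtend hT.le ((Icc 0 T).domRestrict W)) :=
        (continuousOn_iff_continuous_domRestrict.1 hW).Icc_extend'
      exact (continuous_const.sub this).const_smul (Real.sqrt ν)
    · intro s hs
      simp only [IccExtend_of_mem hT.le _ hs, domRestrict_apply]
  have hVb0 : 0 ≤ Vbound := (abs_nonneg _).trans (hVbdd 0)
  have hΘ : Continuous (fun p : ℝ × EuclideanSpace ℝ (Fin n) => (p.1, p.2 - c p.1)) := by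
    fun_prop
  have cmp := comparison (T := T) (M := M) (B := Vbound + 1) hT
    (U := fun p => u p.1 (p.2 - c p.1)) (U' := fun p => v p.1 (p.2 - c p.1))
    (F := fun p => V (p.2 - c p.1)) (cu.comp hΘ) (cv.comp hΘ) (by fun_prop)
    (by linarith) (by linarith) (fun p => bu _ _) (fun p => bv _ _)
    (fun p => (hVbdd _).trans (by linarith))
    (fun φ g s₀ y₀ h1 h2 h3 h4 => sub_transform cc hcW hu_sub φ g s₀ y₀ h1 h2 h3 h4)
    (fun φ g s₀ y₀ h1 h2 h3 h4 => super_transform cc hcW hv_super φ g s₀ y₀ h1 h2 h3 h4)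
    (fun y => (hu_sub.2.2.1 _).trans (hv_super.2.2.1 _))
  have hpos : ∀ s ∈ Ioc 0 T, u s x ≤ v s x := by
    intro s hs
    have := cmp s hs (x + c s)
    simpa using this
  rcases eq_or_lt_of_le hs.1 with h0 | h0
  · subst h0
    have cu0 : Continuous (fun s => u s x) := cu.comp (by fun_prop : Continuous fun s => (s, x))
    have cv0 : Continuous (fun s => v s x) := cv.comp (by fun_prop : Continuous fun s => (s, x))
    have hcl : IsClosed {s | u s x ≤ v s x} := isClosed_le cu0 cv0
    have hsub : closure (Ioc 0 T) ⊆ {s | u s x ≤ v s x} := hcl.closure_subset_iff.2 hpos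
    rw [closure_Ioc hT.ne] at hsub
    exact hsub hs
  · exact hpos s ⟨h0, hs.2⟩

/-- uniqueness: two pathwise viscosity solutions (simultaneously sub- and
supersolutions) of the stochastic HJB equation with terminal data `S` coincide everywhere on
`ℝⁿ × [0,T]`. -/
theorem statement14
    (n : ℕ) (hn : 1 ≤ n) (T ν : ℝ)
    (hT : 0 < T) (hν : 0 < ν)
    (W : ℝ → EuclideanSpace ℝ (Fin n)) (hW : ContinuousOn W (Icc 0 T))
    (V S : EuclideanSpace ℝ (Fin n) → ℝ) (L_V L_S Vbound Sbound : ℝ)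
    (hVlip : ∀ y y', |V y - V y'| ≤ L_V * ‖y - y'‖)
    (hVbdd : ∀ y, |V y| ≤ Vbound)
    (hSlip : ∀ y y', |S y - S y'| ≤ L_S * ‖y - y'‖)
    (hSbdd : ∀ y, |S y| ≤ Sbound)
    (u v : ℝ → EuclideanSpace ℝ (Fin n) → ℝ)
    (hu_sub : IsPathwiseSubsolution T ν W V S u)
    (hu_super : IsPathwiseSupersolution T ν W V S u)
    (hv_sub : IsPathwiseSubsolution T ν W V S v)
    (hv_super : IsPathwiseSupersolution T ν W V S v) :
    ∀ (x : EuclideanSpace ℝ (Fin n)), ∀ s ∈ Icc (0 : ℝ) T, u s x = v s x := by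
  have cV : Continuous V := by
    refine LipschitzWith.continuous (K := L_V.toNNReal) (LipschitzWith.of_dist_le_mul fun y y' => ?_)
    rw [Real.dist_eq, dist_eq_norm]
    refine (hVlip y y').trans ?_
    gcongr
    exact Real.le_coe_toNNReal L_V
  intro x s hs
  exact le_antisymm (main_le hT hW cV hVbdd hu_sub hu_super hv_sub hv_super x s hs)
    (main_le hT hW cV hVbdd hv_sub hv_super hu_sub hu_super x s hs)
end
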